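/- With the spaces Ω_{ν,q} and the operators D_ν, D*_ν defined as in the context, suppose 0 ≤ ν ≤ d, q ≥ 0 and q + d − ν > 0. Then every x ∈ Ω_{ν,q} with D_ν x = 0 lies in the image of D_{ν−1} : Ω_{ν−1,q−1} → Ω_{ν,q} (where this image is interpreted as {0} if ν = 0 or q = 0, so that in those cases x = 0); that is, the sequence Ω_{ν−1,q−1} → Ω_{ν,q} → Ω_{ν+1,q+1} given by the maps D is exact at Ω_{ν,q}. -/

import Mathlib

/-- Index type: pairs `(α, I)` of a multi-index `α : Fin d → ℕ` and a subset
`I ⊆ {1,…,d}`, indexing the currents `δ^{(α)} dy_I` on `ℝ^d`. -/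
abbrev DeltaIdx (d : ℕ) := (Fin d → ℕ) × Finset (Fin d)

/-- The space of finitely supported formal `ℝ`-linear combinations of the symbols
`δ^{(α)} dy_I`. -/
abbrev DeltaSpace (d : ℕ) := DeltaIdx d →₀ ℝ

/-- `♯(I,i)`: the number of elements of `I` strictly smaller than `i`. -/
def sharp {d : ℕ} (I : Finset (Fin d)) (i : Fin d) : ℕ :=
  (I.filter (fun j => j < i)).card

/-- The graded piece `Ω_{ν,q}`: formal combinations of `δ^{(α)} dy_I` with `|α| = q` and
`|I| = ν`. -/
noncomputable def OmegaGrade (d ν q : ℕ) : Submodule ℝ (DeltaSpace d) :=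
  Finsupp.supported ℝ ℝ {p : DeltaIdx d | (∑ i, p.1 i) = q ∧ p.2.card = ν}

/-- The exterior derivative on currents:
`D (δ^{(α)} dy_I) = ∑_{i ∉ I} (−1)^{♯(I,i)} δ^{(α+δ_i)} dy_{I ∪ {i}}`. -/
noncomputable def derD (d : ℕ) : DeltaSpace d →ₗ[ℝ] DeltaSpace d :=
  Finsupp.lsum ℝ (fun p : DeltaIdx d => LinearMap.toSpanSingleton ℝ (DeltaSpace d)
    (∑ i ∈ p.2ᶜ, ((-1 : ℝ) ^ sharp p.2 i) •
      Finsupp.single (p.1 + Pi.single i 1, insert i p.2) (1 : ℝ)))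

/-- The formal adjoint of the exterior derivative:
`D* (δ^{(α)} dy_I) = ∑_{i ∈ I} (−1)^{♯(I,i)−1} α(i) · δ^{(α−δ_i)} dy_{I ∖ {i}}`
(terms with `α(i) = 0` vanish). -/
noncomputable def derDstar (d : ℕ) : DeltaSpace d →ₗ[ℝ] DeltaSpace d :=
  Finsupp.lsum ℝ (fun p : DeltaIdx d => LinearMap.toSpanSingleton ℝ (DeltaSpace d)
    (∑ i ∈ p.2, (((-1 : ℝ) ^ ((sharp p.2 i : ℤ) - 1)) * (p.1 i : ℝ)) •
      Finsupp.single (p.1 - Pi.single i 1, p.2.erase i) (1 : ℝ)))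

lemma derD_single {d : ℕ} (α : Fin d → ℕ) (I : Finset (Fin d)) :
    derD d (Finsupp.single (α, I) 1) =
      ∑ i ∈ Iᶜ, ((-1 : ℝ) ^ sharp I i) • Finsupp.single (α + Pi.single i 1, insert i I) (1 : ℝ) := by
  simp [derD, LinearMap.toSpanSingleton_apply]

lemma derDstar_single {d : ℕ} (α : Fin d → ℕ) (I : Finset (Fin d)) :
    derDstar d (Finsupp.single (α, I) 1) =
      ∑ i ∈ I, (-((-1 : ℝ) ^ sharp I i * (α i : ℝ))) •
        Finsupp.single (α - Pi.single i 1, I.erase i) (1 : ℝ) := by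
  simp only [derDstar, Finsupp.lsum_single, LinearMap.toSpanSingleton_apply, one_smul]
  refine Finset.sum_congr rfl fun i _ => ?_
  rw [zpow_sub₀ (by norm_num), zpow_natCast, zpow_one, div_neg, div_one, neg_mul]

lemma sharp_erase_self {d : ℕ} (I : Finset (Fin d)) (i : Fin d) :
    sharp (I.erase i) i = sharp I i := by
  unfold sharp
  congr 1
  ext j
  simp only [Finset.mem_filter, Finset.mem_erase]
  exact ⟨fun h => ⟨h.1.2, h.2⟩, fun h => ⟨⟨h.2.ne, h.1⟩, h.2⟩⟩

lemma sharp_insert_self {d : ℕ} (I : Finset (Fin d)) (i : Fin d) :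
    sharp (insert i I) i = sharp I i := by
  simp [sharp, Finset.filter_insert]

lemma sharp_insert {d : ℕ} {I : Finset (Fin d)} {i : Fin d} (hi : i ∉ I) (j : Fin d) :
    sharp (insert i I) j = sharp I j + if i < j then 1 else 0 := by
  unfold sharp
  rw [Finset.filter_insert]
  split_ifs with h
  · rw [Finset.card_insert_of_notMem (by simp [hi])]
  · rfl

lemma sharp_erase {d : ℕ} {I : Finset (Fin d)} {j : Fin d} (hj : j ∈ I) (i : Fin d) :
    sharp I i = sharp (I.erase j) i + if j < i then 1 else 0 := by
  conv_lhs => rw [← Finset.insert_erase hj]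
  exact sharp_insert (Finset.notMem_erase j I) i

/-- The signs of adding `i` and removing `j` anticommute. -/
lemma sign_insert_erase {d : ℕ} {I : Finset (Fin d)} {i j : Fin d} (hi : i ∉ I) (hj : j ∈ I) :
    (-1 : ℝ) ^ sharp I i * (-1) ^ sharp (insert i I) j =
      -((-1) ^ sharp I j * (-1) ^ sharp (I.erase j) i) := by
  have hij : i ≠ j := fun h => hi (h ▸ hj)
  rw [sharp_insert hi, sharp_erase hj i]
  rcases lt_or_gt_of_ne hij with h | h
  · simp only [h, h.not_gt, if_true, if_false]
    ring
  · simp only [h, h.not_gt, if_true, if_false]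
    ring

lemma single_le_of_pos {d : ℕ} {α : Fin d → ℕ} {i : Fin d} (h : 0 < α i) : Pi.single i 1 ≤ α := by
  intro k
  rcases eq_or_ne k i with rfl | hk
  · simpa using Nat.succ_le_of_lt h
  · simp [hk]

lemma neg_one_pow_mul_self (n : ℕ) : (-1 : ℝ) ^ n * (-1) ^ n = 1 := by
  rw [← mul_pow]; simp

lemma derDstar_derD_single {d : ℕ} (α : Fin d → ℕ) (I : Finset (Fin d)) :
    derDstar d (derD d (Finsupp.single (α, I) 1)) =
      -(∑ i ∈ Iᶜ, ((α i : ℝ) + 1)) • Finsupp.single (α, I) (1 : ℝ) +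
      ∑ i ∈ Iᶜ, ∑ j ∈ I, ((-1 : ℝ) ^ sharp I j * (-1) ^ sharp (I.erase j) i * α j) •
        Finsupp.single (α - Pi.single j 1 + Pi.single i 1, insert i (I.erase j)) (1 : ℝ) := by
  rw [derD_single, map_sum, ← Finset.sum_neg_distrib, Finset.sum_smul, ← Finset.sum_add_distrib]
  refine Finset.sum_congr rfl fun i hi => ?_
  rw [Finset.mem_compl] at hi
  rw [map_smul, derDstar_single, Finset.sum_insert hi, smul_add, Finset.smul_sum, smul_smul]
  congr 1
  · rw [sharp_insert_self, Finset.erase_insert hi, add_tsub_cancel_right, mul_neg, ← mul_assoc,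
      neg_one_pow_mul_self]
    simp
  · refine Finset.sum_congr rfl fun j hj => ?_
    have hij : j ≠ i := fun h => hi (h ▸ hj)
    rw [smul_smul, mul_neg, ← mul_assoc, sign_insert_erase hi hj, neg_mul, neg_neg,
      Finset.erase_insert_of_ne hij.symm]
    have hα : (α + Pi.single i 1 : Fin d → ℕ) j = α j := by simp [hij]
    rw [hα]
    rcases Nat.eq_zero_or_pos (α j) with h0 | h0
    · simp [h0]
    · rw [tsub_add_eq_add_tsub (single_le_of_pos h0)]

lemma derD_derDstar_single {d : ℕ} (α : Fin d → ℕ) (I : Finset (Fin d)) :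
    derD d (derDstar d (Finsupp.single (α, I) 1)) =
      -(∑ j ∈ I, (α j : ℝ)) • Finsupp.single (α, I) (1 : ℝ) -
      ∑ i ∈ Iᶜ, ∑ j ∈ I, ((-1 : ℝ) ^ sharp I j * (-1) ^ sharp (I.erase j) i * α j) •
        Finsupp.single (α - Pi.single j 1 + Pi.single i 1, insert i (I.erase j)) (1 : ℝ) := by
  rw [derDstar_single, map_sum, Finset.sum_comm, ← Finset.sum_neg_distrib, Finset.sum_smul,
    ← Finset.sum_sub_distrib]
  refine Finset.sum_congr rfl fun j hj => ?_
  rw [map_smul, derD_single, Finset.compl_erase, Finset.sum_insert (by simpa using hj), smul_add,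
    Finset.smul_sum, smul_smul, sub_eq_add_neg, ← Finset.sum_neg_distrib]
  congr 1
  · rw [sharp_erase_self, Finset.insert_erase hj, neg_mul, mul_right_comm, neg_one_pow_mul_self,
      one_mul]
    rcases Nat.eq_zero_or_pos (α j) with h0 | h0
    · simp [h0]
    · rw [tsub_add_cancel_of_le (single_le_of_pos h0)]
  · refine Finset.sum_congr rfl fun i _ => ?_
    rw [smul_smul, ← neg_smul]
    congr 1
    ring

/-- The Laplacian `D* D + D D*` is diagonal in the basis `δ^{(α)} dy_I`. -/
lemma laplacian_single {d : ℕ} (α : Fin d → ℕ) (I : Finset (Fin d)) :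
    derDstar d (derD d (Finsupp.single (α, I) 1)) + derD d (derDstar d (Finsupp.single (α, I) 1)) =
      -((∑ i, α i : ℕ) + (d - I.card : ℕ) : ℝ) • Finsupp.single (α, I) (1 : ℝ) := by
  rw [derDstar_derD_single, derD_derDstar_single, add_add_sub_cancel, ← add_smul]
  congr 1
  rw [Finset.sum_add_distrib, Finset.sum_const, Finset.card_compl, Fintype.card_fin,
    ← Finset.sum_add_sum_compl I α]
  push_cast
  simp only [nsmul_eq_mul, mul_one]
  ring

lemma OmegaGrade_eq_span (d ν q : ℕ) :
    OmegaGrade d ν q = Submodule.span ℝ ((fun p : DeltaIdx d => Finsupp.single p (1 : ℝ)) ''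
      {p | (∑ i, p.1 i) = q ∧ p.2.card = ν}) :=
  Finsupp.supported_eq_span_single ℝ _

lemma laplacian_eq_smul {d ν q : ℕ} {x : DeltaSpace d} (hx : x ∈ OmegaGrade d ν q) :
    derDstar d (derD d x) + derD d (derDstar d x) = -((q : ℝ) + (d - ν : ℕ)) • x := by
  rw [OmegaGrade_eq_span] at hx
  have h := LinearMap.eqOn_span' (f := derDstar d ∘ₗ derD d + derD d ∘ₗ derDstar d)
    (g := (-((q : ℝ) + (d - ν : ℕ))) • LinearMap.id) ?_ hx
  · simpa using h
  · rintro _ ⟨⟨α, I⟩, ⟨hα, hI⟩, rfl⟩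
    subst hα hI
    exact laplacian_single α I

lemma derDstar_mem {d ν q : ℕ} {x : DeltaSpace d} (hx : x ∈ OmegaGrade d ν q) :
    derDstar d x ∈ OmegaGrade d (ν - 1) (q - 1) := by
  rw [OmegaGrade_eq_span] at hx
  refine (Submodule.map_span_le (derDstar d) _ _).2 ?_ (Submodule.mem_map_of_mem hx)
  rintro _ ⟨⟨α, I⟩, ⟨hα, hI⟩, rfl⟩
  subst hα hI
  rw [derDstar_single]
  refine Submodule.sum_mem _ fun i hi => ?_
  rcases Nat.eq_zero_or_pos (α i) with h0 | h0
  · simp [h0]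
  · refine Submodule.smul_mem _ _ (Finsupp.single_mem_supported ℝ _ ⟨?_, Finset.card_erase_of_mem hi⟩)
    have h := congrArg (fun β : Fin d → ℕ => ∑ k, β k) (tsub_add_cancel_of_le (single_le_of_pos h0))
    simp only [Pi.add_apply, Finset.sum_add_distrib, Finset.sum_pi_single', Finset.mem_univ,
      if_true] at h
    exact Nat.eq_sub_of_add_eq h

lemma derDstar_eq_zero {d ν q : ℕ} (h : ν = 0 ∨ q = 0) {x : DeltaSpace d}
    (hx : x ∈ OmegaGrade d ν q) : derDstar d x = 0 := by
  rw [OmegaGrade_eq_span] at hx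
  refine LinearMap.eqOn_span' (f := derDstar d) (g := 0) ?_ hx
  rintro _ ⟨⟨α, I⟩, ⟨hα, hI⟩, rfl⟩
  rw [LinearMap.zero_apply, derDstar_single]
  refine Finset.sum_eq_zero fun i hi => ?_
  rcases h with rfl | rfl
  · exact absurd (Finset.card_eq_zero.1 hI ▸ hi) (Finset.notMem_empty i)
  · have h0 : α i = 0 := Finset.sum_eq_zero_iff.1 hα i (Finset.mem_univ i)
    simp [h0]

/-- Poincaré-lemma exactness of the complex `(Ω_{ν,q}, D)`: if `0 ≤ ν ≤ d`, `q ≥ 0` and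
`q + d − ν > 0`, then every `x ∈ Ω_{ν,q}` with `D x = 0` lies in the image of
`D : Ω_{ν−1,q−1} → Ω_{ν,q}`; in the degenerate cases `ν = 0` or `q = 0` (where that image is
interpreted as `{0}`) one has `x = 0`. -/
theorem derD_exact (d ν q : ℕ) (hν : ν ≤ d) (hpos : 0 < q + (d - ν)) :
    ∀ x ∈ OmegaGrade d ν q, derD d x = 0 →
      ((ν = 0 ∨ q = 0) → x = 0) ∧
      (0 < ν → 0 < q → ∃ y ∈ OmegaGrade d (ν - 1) (q - 1), derD d y = x) := by
  intro x hx hDx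
  have hc : -((q : ℝ) + (d - ν : ℕ)) ≠ 0 := neg_ne_zero.2 (by exact_mod_cast hpos.ne')
  have hlap := laplacian_eq_smul hx
  rw [hDx, map_zero, zero_add] at hlap
  refine ⟨fun h => ?_, fun _ _ => ⟨(-((q : ℝ) + (d - ν : ℕ)))⁻¹ • derDstar d x,
    Submodule.smul_mem _ _ (derDstar_mem hx), ?_⟩⟩
  · rw [derDstar_eq_zero h hx, map_zero] at hlap
    exact (smul_eq_zero.1 hlap.symm).resolve_left hc
  · rw [map_smul, hlap, inv_smul_smul₀ hc]
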